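/- arXiv:2101.04343 — 6 statements merged into one kernel-verified Lean document; each statement's English description precedes it below -/
import Mathlib

section
/- For every 1 ≤ ℓ ≤ N and every orthonormal family ψ_1, …, ψ_ℓ in V, the weighted projection error is bounded below by the tail of the eigenvalues of R: Σ_{j=0}^n α_j ‖y_j − Σ_{i=1}^ℓ ⟨y_j, ψ_i⟩ ψ_i‖² ≥ Σ_{i=ℓ+1}^N λ_i. -/
open scoped RealInnerProductSpace

/-- for `1 ≤ ℓ ≤ N` and any orthonormal family `ψ_1, …, ψ_ℓ`, the
weighted projection error is bounded below by the tail of the eigenvalues of `R`: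
`∑_j α_j ‖y_j − ∑_{i=1}^ℓ ⟪y_j, ψ_i⟫ ψ_i‖² ≥ ∑_{i=ℓ+1}^N λ_i`. -/
theorem weighted_projection_error_ge_eigenvalue_tail
    {V : Type*} [NormedAddCommGroup V] [InnerProductSpace ℝ V]
    [FiniteDimensional ℝ V] {N n : ℕ} (hN : Module.finrank ℝ V = N)
    (y : Fin (n + 1) → V) (α : Fin (n + 1) → ℝ) (hα : ∀ j, 0 < α j)
    (R : V →ₗ[ℝ] V)
    (hR : ∀ ψ : V, R ψ = ∑ j, α j • (⟪ψ, y j⟫ : ℝ) • y j)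
    (e : OrthonormalBasis (Fin N) ℝ V) (lam : Fin N → ℝ)
    (heig : ∀ i, R (e i) = lam i • e i)
    (hdecr : Antitone lam) (hnonneg : ∀ i, 0 ≤ lam i)
    {ℓ : ℕ} (hℓ1 : 1 ≤ ℓ) (hℓ : ℓ ≤ N)
    (ψ : Fin ℓ → V) (hψ : Orthonormal ℝ ψ) :
    ∑ j, α j * ‖y j - ∑ i, (⟪y j, ψ i⟫ : ℝ) • ψ i‖ ^ 2
      ≥ ∑ i ∈ Finset.univ.filter (fun i : Fin N => ℓ ≤ (i : ℕ)), lam i := by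
  have hq : ∀ v : V, ∑ j, α j * (⟪y j, v⟫ : ℝ) ^ 2 = ⟪R v, v⟫ := by
    intro v
    rw [hR, sum_inner]
    refine Finset.sum_congr rfl fun j _ => ?_
    rw [real_inner_smul_left, real_inner_smul_left, real_inner_comm v (y j)]
    ring
  have hq2 : ∀ v : V, (⟪R v, v⟫ : ℝ) = ∑ k, lam k * (⟪e k, v⟫ : ℝ) ^ 2 := by
    intro v
    have h1 : R v = ∑ k, (⟪e k, v⟫ : ℝ) • lam k • e k := by
      conv_lhs => rw [← e.sum_repr' v]
      rw [map_sum]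
      refine Finset.sum_congr rfl fun k _ => ?_
      rw [map_smul, heig]
    rw [h1, sum_inner]
    refine Finset.sum_congr rfl fun k _ => ?_
    rw [real_inner_smul_left, real_inner_smul_left]
    ring
  have hpars : ∀ v : V, ∑ k, (⟪e k, v⟫ : ℝ) ^ 2 = ‖v‖ ^ 2 := by
    intro v
    simpa using e.sum_sq_norm_inner_right v
  have hproj : ∀ v : V, ‖v - ∑ i, (⟪v, ψ i⟫ : ℝ) • ψ i‖ ^ 2
      = ‖v‖ ^ 2 - ∑ i, (⟪v, ψ i⟫ : ℝ) ^ 2 := by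
    intro v
    have h1 : (⟪v, ∑ i, (⟪v, ψ i⟫ : ℝ) • ψ i⟫ : ℝ) = ∑ i, (⟪v, ψ i⟫ : ℝ) ^ 2 := by
      rw [inner_sum]
      refine Finset.sum_congr rfl fun k _ => ?_
      rw [real_inner_smul_right]
      ring
    have h2 : ‖∑ i, (⟪v, ψ i⟫ : ℝ) • ψ i‖ ^ 2 = ∑ i, (⟪v, ψ i⟫ : ℝ) ^ 2 := by
      rw [← real_inner_self_eq_norm_sq, hψ.inner_sum]
      refine Finset.sum_congr rfl fun k _ => ?_
      simp [sq]
    rw [norm_sub_sq_real, h1, h2]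
    ring
  set c : Fin N → ℝ := fun k => ∑ i, (⟪e k, ψ i⟫ : ℝ) ^ 2 with hc
  have hc0 : ∀ k, 0 ≤ c k := fun k => Finset.sum_nonneg fun i _ => sq_nonneg _
  have hc1 : ∀ k, c k ≤ 1 := by
    intro k
    have h := hproj (e k)
    have h0 := sq_nonneg ‖e k - ∑ i, (⟪e k, ψ i⟫ : ℝ) • ψ i‖
    rw [h, e.norm_eq_one] at h0
    simp only [hc]
    linarith
  have hcs : ∑ k, c k = ℓ := by
    simp only [hc]
    rw [Finset.sum_comm]
    simp [hpars, hψ.norm_eq_one]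
  have htr : ∑ j, α j * ‖y j‖ ^ 2 = ∑ k, lam k := by
    simp_rw [← hpars, Finset.mul_sum]
    rw [Finset.sum_comm]
    refine Finset.sum_congr rfl fun k _ => ?_
    simp_rw [real_inner_comm (y _) (e k)]
    rw [hq, heig, real_inner_smul_left, real_inner_self_eq_norm_sq, e.norm_eq_one]
    ring
  have hL : ∑ j, α j * ‖y j - ∑ i, (⟪y j, ψ i⟫ : ℝ) • ψ i‖ ^ 2
      = ∑ k, lam k * (1 - c k) := by
    simp_rw [hproj, mul_sub, Finset.sum_sub_distrib, htr, Finset.mul_sum]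
    rw [Finset.sum_comm]
    simp_rw [hq, hq2, hc, Finset.mul_sum, mul_one]
    rw [Finset.sum_comm]
  rw [hL, ge_iff_le, Finset.sum_filter]
  let m : Fin N := ⟨ℓ - 1, by omega⟩
  have hcnt : ∑ k : Fin N, (if ℓ ≤ (k : ℕ) then (1 : ℝ) else 0) = N - ℓ := by
    rw [Fin.sum_univ_eq_sum_range (fun k => if ℓ ≤ k then (1 : ℝ) else 0) N,
      ← Finset.sum_range_add_sum_Ico _ hℓ]
    rw [Finset.sum_eq_zero (s := Finset.range ℓ), Finset.sum_congr rfl (s₁ := Finset.Ico ℓ N)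
      (g := fun _ => (1 : ℝ))]
    · simp [Nat.cast_sub hℓ]
    · intro k hk
      simp [(Finset.mem_Ico.1 hk).1]
    · intro k hk
      simp [Finset.mem_range.1 hk]
  have hz : ∑ k : Fin N, lam m * ((1 - c k) - (if ℓ ≤ (k : ℕ) then (1 : ℝ) else 0)) = 0 := by
    rw [← Finset.mul_sum, Finset.sum_sub_distrib, Finset.sum_sub_distrib, hcnt, hcs]
    simp
  have hle : ∑ k : Fin N, lam m * ((1 - c k) - (if ℓ ≤ (k : ℕ) then (1 : ℝ) else 0))
      ≤ ∑ k : Fin N, (lam k * (1 - c k) - (if ℓ ≤ (k : ℕ) then lam k else 0)) := by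
    refine Finset.sum_le_sum fun k _ => ?_
    by_cases hk : ℓ ≤ (k : ℕ)
    · have : lam k ≤ lam m := hdecr (by rw [Fin.le_def]; simp only [m]; omega)
      simp only [hk, if_true]
      nlinarith [hc0 k]
    · have : lam m ≤ lam k := hdecr (by rw [Fin.le_def]; simp only [m]; omega)
      simp only [hk, if_false]
      nlinarith [hc1 k]
  rw [hz, Finset.sum_sub_distrib] at hle
  linarith
end

section
/- If ψ_1, …, ψ_ℓ is an orthonormal family of eigenvectors of R with Rψ_i = λ_i ψ_i for i = 1, …, ℓ, where λ_1 ≥ … ≥ λ_ℓ are the ℓ largest eigenvalues of R, then the weighted projection error equals exactly the tail of the spectrum: Σ_{j=0}^n α_j ‖y_j − Σ_{i=1}^ℓ ⟨y_j, ψ_i⟩ ψ_i‖² = Σ_{i=ℓ+1}^N λ_i. -/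
open scoped RealInnerProductSpace

/-- if `ψ_1, …, ψ_ℓ` is an orthonormal family of eigenvectors of `R`
associated with the `ℓ` largest eigenvalues `λ_1 ≥ … ≥ λ_ℓ`, then the weighted
projection error equals exactly the tail of the spectrum:
`∑_j α_j ‖y_j − ∑_{i=1}^ℓ ⟪y_j, ψ_i⟫ ψ_i‖² = ∑_{i=ℓ+1}^N λ_i`. -/
theorem weighted_projection_error_eq_eigenvalue_tail
    {V : Type*} [NormedAddCommGroup V] [InnerProductSpace ℝ V]
    [FiniteDimensional ℝ V] {N n : ℕ} (hN : Module.finrank ℝ V = N)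
    (y : Fin (n + 1) → V) (α : Fin (n + 1) → ℝ) (hα : ∀ j, 0 < α j)
    (R : V →ₗ[ℝ] V)
    (hR : ∀ ψ : V, R ψ = ∑ j, α j • (⟪ψ, y j⟫ : ℝ) • y j)
    (e : OrthonormalBasis (Fin N) ℝ V) (lam : Fin N → ℝ)
    (heig : ∀ i, R (e i) = lam i • e i)
    (hdecr : Antitone lam) (hnonneg : ∀ i, 0 ≤ lam i)
    {ℓ : ℕ} (hℓ1 : 1 ≤ ℓ) (hℓ : ℓ ≤ N)
    (ψ : Fin ℓ → V) (hψ : Orthonormal ℝ ψ)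
    (heigψ : ∀ i : Fin ℓ, R (ψ i) = lam (Fin.castLE hℓ i) • ψ i) :
    ∑ j, α j * ‖y j - ∑ i, (⟪y j, ψ i⟫ : ℝ) • ψ i‖ ^ 2
      = ∑ i ∈ Finset.univ.filter (fun i : Fin N => ℓ ≤ (i : ℕ)), lam i := by
  have key : ∀ v : V, ∀ c : ℝ, ‖v‖ = 1 → R v = c • v → ∑ j, α j * (⟪y j, v⟫ : ℝ) ^ 2 = c := by
    intro v c hv hc
    have h1 : (⟪R v, v⟫ : ℝ) = c := by
      rw [hc, real_inner_smul_left, real_inner_self_eq_norm_sq, hv]; ring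
    rw [← h1, hR, sum_inner]
    refine Finset.sum_congr rfl fun j _ => ?_
    rw [real_inner_smul_left, real_inner_smul_left, real_inner_comm (y j) v]
    ring
  have hproj : ∀ x : V, ‖x - ∑ i, (⟪x, ψ i⟫ : ℝ) • ψ i‖ ^ 2
      = ‖x‖ ^ 2 - ∑ i, (⟪x, ψ i⟫ : ℝ) ^ 2 := by
    intro x
    have h2 : (⟪x, ∑ i, (⟪x, ψ i⟫ : ℝ) • ψ i⟫ : ℝ) = ∑ i, (⟪x, ψ i⟫ : ℝ) ^ 2 := by
      rw [inner_sum]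
      refine Finset.sum_congr rfl fun i _ => ?_
      rw [real_inner_smul_right]; ring
    have h3 : ‖∑ i, (⟪x, ψ i⟫ : ℝ) • ψ i‖ ^ 2 = ∑ i, (⟪x, ψ i⟫ : ℝ) ^ 2 := by
      rw [← real_inner_self_eq_norm_sq, hψ.inner_sum]
      refine Finset.sum_congr rfl fun i _ => ?_
      simp [sq]
    rw [norm_sub_sq_real, h2, h3]; ring
  have hnorm : ∀ x : V, ‖x‖ ^ 2 = ∑ i, (⟪x, e i⟫ : ℝ) ^ 2 := by
    intro x
    rw [← e.sum_sq_norm_inner_left x]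
    simp
  have hall : ∑ j, α j * ‖y j‖ ^ 2 = ∑ i, lam i := by
    simp_rw [hnorm, Finset.mul_sum]
    rw [Finset.sum_comm]
    exact Finset.sum_congr rfl fun i _ => key _ _ (e.orthonormal.1 i) (heig i)
  have hpart : ∑ j, α j * ∑ i, (⟪y j, ψ i⟫ : ℝ) ^ 2 = ∑ i : Fin ℓ, lam (Fin.castLE hℓ i) := by
    simp_rw [Finset.mul_sum]
    rw [Finset.sum_comm]
    exact Finset.sum_congr rfl fun i _ => key _ _ (hψ.1 i) (heigψ i)
  have hhead : ∑ i : Fin ℓ, lam (Fin.castLE hℓ i)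
      = ∑ i ∈ Finset.univ.filter (fun i : Fin N => ¬ ℓ ≤ (i : ℕ)), lam i := by
    refine Finset.sum_bij (fun i _ => Fin.castLE hℓ i) ?_ ?_ ?_ ?_
    · intro i _; simp
    · intro a _ b _ h; exact Fin.castLE_injective hℓ h
    · intro b hb
      simp only [Finset.mem_filter, Finset.mem_univ, true_and, not_le] at hb
      exact ⟨⟨b, hb⟩, Finset.mem_univ _, rfl⟩
    · intro i _; rfl
  simp_rw [hproj, mul_sub]
  rw [Finset.sum_sub_distrib, hall, hpart, hhead,
    ← Finset.sum_filter_add_sum_filter_not Finset.univ (fun i : Fin N => ℓ ≤ (i : ℕ)) lam]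
  ring
end

section
/- Any orthonormal family ψ_1, …, ψ_ℓ of eigenvectors of R associated with the ℓ largest eigenvalues λ_1 ≥ … ≥ λ_ℓ solves the POD minimization problem: it minimizes Σ_{j=0}^n α_j ‖y_j − Σ_{i=1}^ℓ ⟨y_j, φ_i⟩ φ_i‖² over all orthonormal families φ_1, …, φ_ℓ in V. -/
open scoped RealInnerProductSpace

lemma pod_weights {l m : ℕ} (hl : 1 ≤ l) (lam w : Fin (l + m) → ℝ) (hd : Antitone lam)
    (hw0 : ∀ k, 0 ≤ w k) (hw1 : ∀ k, w k ≤ 1) (hs : ∑ k, w k = l) :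
    ∑ k, lam k * w k ≤ ∑ i : Fin l, lam (Fin.castAdd m i) := by
  set μ := lam (Fin.castAdd m ⟨l - 1, by omega⟩) with hμ
  have h1 : ∀ i : Fin l, (lam (Fin.castAdd m i) - μ) * w (Fin.castAdd m i)
      ≤ lam (Fin.castAdd m i) - μ := fun i => by
    have : μ ≤ lam (Fin.castAdd m i) := hd (by
      rw [Fin.le_def]; simp only [Fin.val_castAdd]; omega)
    nlinarith [hw1 (Fin.castAdd m i)]
  have h2 : ∀ i : Fin m, (lam (Fin.natAdd l i) - μ) * w (Fin.natAdd l i) ≤ 0 := fun i => by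
    have : lam (Fin.natAdd l i) ≤ μ := hd (by
      rw [Fin.le_def]; simp only [Fin.val_castAdd, Fin.val_natAdd]; omega)
    nlinarith [hw0 (Fin.natAdd l i)]
  have h3 : ∑ k, (lam k - μ) * w k ≤ ∑ i : Fin l, (lam (Fin.castAdd m i) - μ) := by
    rw [Fin.sum_univ_add]
    have a := Finset.sum_le_sum (fun i (_ : i ∈ Finset.univ) => h1 i)
    have b := Finset.sum_nonpos (fun i (_ : i ∈ Finset.univ) => h2 i)
    linarith
  simp only [sub_mul, Finset.sum_sub_distrib, ← Finset.mul_sum, hs] at h3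
  simp only [Finset.sum_const, Finset.card_univ, Fintype.card_fin, nsmul_eq_mul] at h3
  linarith

lemma pod_err {V : Type*} [NormedAddCommGroup V] [InnerProductSpace ℝ V] {l : ℕ}
    (φ : Fin l → V) (hφ : Orthonormal ℝ φ) (y : V) :
    ‖y - ∑ i, (⟪y, φ i⟫ : ℝ) • φ i‖ ^ 2 = ‖y‖ ^ 2 - ∑ i, (⟪y, φ i⟫ : ℝ) ^ 2 := by
  have h1 : ⟪y, ∑ i, (⟪y, φ i⟫ : ℝ) • φ i⟫ = ∑ i, (⟪y, φ i⟫ : ℝ) ^ 2 := by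
    simp only [inner_sum, inner_smul_right, sq]
  have h2 : ‖∑ i, (⟪y, φ i⟫ : ℝ) • φ i‖ ^ 2 = ∑ i, (⟪y, φ i⟫ : ℝ) ^ 2 := by
    rw [← real_inner_self_eq_norm_sq, hφ.inner_sum]
    simp [sq]
  rw [norm_sub_sq_real, h1, h2]; ring

lemma pod_total {V : Type*} [NormedAddCommGroup V] [InnerProductSpace ℝ V] {l n : ℕ}
    (y : Fin (n + 1) → V) (α : Fin (n + 1) → ℝ) (R : V →ₗ[ℝ] V)
    (hR : ∀ ψ : V, R ψ = ∑ j, α j • (⟪ψ, y j⟫ : ℝ) • y j)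
    (φ : Fin l → V) (hφ : Orthonormal ℝ φ) :
    ∑ j, α j * ‖y j - ∑ i, (⟪y j, φ i⟫ : ℝ) • φ i‖ ^ 2
      = ∑ j, α j * ‖y j‖ ^ 2 - ∑ i, ⟪R (φ i), φ i⟫ := by
  simp only [pod_err φ hφ, mul_sub, Finset.sum_sub_distrib, Finset.mul_sum]
  rw [Finset.sum_comm]
  congr 1
  refine Finset.sum_congr rfl fun i _ => ?_
  rw [hR, sum_inner]
  refine Finset.sum_congr rfl fun j _ => ?_
  rw [real_inner_smul_left, real_inner_smul_left, real_inner_comm (y j) (φ i)]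
  ring


/-- any orthonormal family `ψ_1, …, ψ_ℓ` of eigenvectors of `R` associated
with the `ℓ` largest eigenvalues `λ_1 ≥ … ≥ λ_ℓ` solves the POD minimization problem:
it minimizes the weighted projection error over all orthonormal families `φ_1, …, φ_ℓ`. -/
theorem pod_basis_minimizes_projection_error
    {V : Type*} [NormedAddCommGroup V] [InnerProductSpace ℝ V]
    [FiniteDimensional ℝ V] {N n : ℕ} (hN : Module.finrank ℝ V = N)
    (y : Fin (n + 1) → V) (α : Fin (n + 1) → ℝ) (hα : ∀ j, 0 < α j)
    (R : V →ₗ[ℝ] V)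
    (hR : ∀ ψ : V, R ψ = ∑ j, α j • (⟪ψ, y j⟫ : ℝ) • y j)
    (e : OrthonormalBasis (Fin N) ℝ V) (lam : Fin N → ℝ)
    (heig : ∀ i, R (e i) = lam i • e i)
    (hdecr : Antitone lam) (hnonneg : ∀ i, 0 ≤ lam i)
    {ℓ : ℕ} (hℓ1 : 1 ≤ ℓ) (hℓ : ℓ ≤ N)
    (ψ : Fin ℓ → V) (hψ : Orthonormal ℝ ψ)
    (heigψ : ∀ i : Fin ℓ, R (ψ i) = lam (Fin.castLE hℓ i) • ψ i)
    (φ : Fin ℓ → V) (hφ : Orthonormal ℝ φ) :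
    ∑ j, α j * ‖y j - ∑ i, (⟪y j, ψ i⟫ : ℝ) • ψ i‖ ^ 2
      ≤ ∑ j, α j * ‖y j - ∑ i, (⟪y j, φ i⟫ : ℝ) • φ i‖ ^ 2 := by

  rw [pod_total y α R hR ψ hψ, pod_total y α R hR φ hφ]
  obtain ⟨m, rfl⟩ := Nat.exists_eq_add_of_le hℓ
  have hq : ∀ v : V, ⟪R v, v⟫ = ∑ k, lam k * (⟪e k, v⟫ : ℝ) ^ 2 := fun v => by
    have : R v = ∑ k, (⟪e k, v⟫ : ℝ) • lam k • e k := by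
      conv_lhs => rw [← e.sum_repr' v]
      simp [heig]
    rw [this, sum_inner]
    refine Finset.sum_congr rfl fun k _ => ?_
    rw [real_inner_smul_left, real_inner_smul_left]; ring
  have hψs : ∑ i, ⟪R (ψ i), ψ i⟫ = ∑ i : Fin ℓ, lam (Fin.castAdd m i) := by
    refine Finset.sum_congr rfl fun i _ => ?_
    rw [heigψ, real_inner_smul_left, real_inner_self_eq_norm_sq, hψ.1 i]
    simp; rfl
  have hφs : ∑ i, ⟪R (φ i), φ i⟫ = ∑ k, lam k * ∑ i, (⟪e k, φ i⟫ : ℝ) ^ 2 := by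
    simp only [hq, Finset.mul_sum]
    exact Finset.sum_comm
  have := pod_weights hℓ1 lam (fun k => ∑ i, (⟪e k, φ i⟫ : ℝ) ^ 2) hdecr
    (fun k => Finset.sum_nonneg fun i _ => sq_nonneg _)
    (fun k => by
      have := pod_err φ hφ (e k)
      have h2 := sq_nonneg ‖e k - ∑ i, (⟪e k, φ i⟫ : ℝ) • φ i‖
      rw [this, e.orthonormal.1 k] at h2
      linarith)
    (by
      rw [Finset.sum_comm]
      have : ∀ i, ∑ k, (⟪e k, φ i⟫ : ℝ) ^ 2 = 1 := fun i => by
        have := e.sum_sq_norm_inner_right (φ i)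
        rw [hφ.1 i] at this
        simpa using this
      simp [this])
  rw [hψs, hφs]
  linarith
end

section
/- Let z̄ = (ū, w̄) ∈ Z be the minimizer of J over Z, let z^ap = (u^ap, w^ap) ∈ Z be arbitrary, and suppose ζ ∈ U × W satisfies the perturbed variational inequality ⟨(u^ap, σw^ap) + ζ, z − z^ap⟩ ≥ 0 for all z ∈ Z. Then ‖z̄ − z^ap‖ ≤ ‖ζ‖ / min{σ, 1}. -/
open scoped RealInnerProductSpace

/-- if `z̄ ∈ Z` minimizes `J` over `Z` and `z^ap ∈ Z` satisfies the
perturbed variational inequality `⟨(u^ap, σw^ap) + ζ, z − z^ap⟩ ≥ 0` for all `z ∈ Z`,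
then `‖z̄ − z^ap‖ ≤ ‖ζ‖ / min{σ,1}` (with the Hilbert norm on `U × W`, i.e.
`‖(u,w)‖ = √(‖u‖² + ‖w‖²)`). -/
theorem a_posteriori_error_bound
    {U W : Type*} [NormedAddCommGroup U] [InnerProductSpace ℝ U] [CompleteSpace U]
    [NormedAddCommGroup W] [InnerProductSpace ℝ W] [CompleteSpace W]
    (σ : ℝ) (hσ : 0 < σ) (J : U × W → ℝ)
    (hJ : ∀ z : U × W, J z = (1 / 2) * ‖z.1‖ ^ 2 + (σ / 2) * ‖z.2‖ ^ 2)
    (Z : Set (U × W)) (hne : Z.Nonempty) (hclosed : IsClosed Z) (hconv : Convex ℝ Z)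
    (zbar : U × W) (hzbar : zbar ∈ Z) (hmin : ∀ z ∈ Z, J zbar ≤ J z)
    (zap : U × W) (hzap : zap ∈ Z) (ζ : U × W)
    (hvi : ∀ z ∈ Z,
      0 ≤ ⟪zap.1 + ζ.1, z.1 - zap.1⟫ + ⟪σ • zap.2 + ζ.2, z.2 - zap.2⟫) :
    Real.sqrt (‖zbar.1 - zap.1‖ ^ 2 + ‖zbar.2 - zap.2‖ ^ 2)
      ≤ Real.sqrt (‖ζ.1‖ ^ 2 + ‖ζ.2‖ ^ 2) / min σ 1 := by
  obtain ⟨p, q⟩ := zbar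
  obtain ⟨x, y⟩ := zap
  obtain ⟨e, f⟩ := ζ
  simp only at hvi ⊢
  obtain ⟨a, rfl⟩ : ∃ a, p = x + a := ⟨p - x, by abel⟩
  obtain ⟨b, rfl⟩ : ∃ b, q = y + b := ⟨q - y, by abel⟩
  have h1 := hvi _ hzbar
  simp only [add_sub_cancel_left, inner_add_left, real_inner_smul_left] at h1 ⊢
  have key : ∀ t : ℝ, 0 < t → t ≤ 1 →
      ⟪x, a⟫ + ‖a‖ ^ 2 + σ * (⟪y, b⟫ + ‖b‖ ^ 2) ≤ t / 2 * (‖a‖ ^ 2 + σ * ‖b‖ ^ 2) := by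
    intro t ht ht1
    have hm := hconv hzbar hzap (sub_nonneg.2 ht1) ht.le (by ring)
    have h := hmin _ hm
    rw [hJ, hJ] at h
    have e1 : (1 - t) • (x + a) + t • x = x + (1 - t) • a := by module
    have e2 : (1 - t) • (y + b) + t • y = y + (1 - t) • b := by module
    simp only [Prod.smul_mk, Prod.mk_add_mk, e1, e2, norm_add_sq_real, norm_smul,
      real_inner_smul_right, mul_pow, Real.norm_eq_abs, sq_abs] at h
    refine le_of_mul_le_mul_left ?_ ht
    nlinarith [h]
  set P := ⟪x, a⟫ + ‖a‖ ^ 2 + σ * (⟪y, b⟫ + ‖b‖ ^ 2) with hP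
  set Q := ‖a‖ ^ 2 + σ * ‖b‖ ^ 2 with hQ
  have hQ0 : 0 ≤ Q := by positivity
  have hP0 : P ≤ 0 := by
    by_contra hc
    push Not at hc
    have h := key (P / (P + Q)) (by positivity) ((div_le_one (by positivity)).2 (by linarith))
    have e3 : P / (P + Q) / 2 * Q = P * Q / (2 * (P + Q)) := by field_simp
    rw [e3, le_div_iff₀ (by positivity)] at h
    nlinarith [mul_pos hc hc, mul_nonneg hc.le hQ0]
  have hca := real_inner_le_norm e a
  have hcb := real_inner_le_norm f b
  have hQle : Q ≤ ‖e‖ * ‖a‖ + ‖f‖ * ‖b‖ := by nlinarith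
  set m := min σ 1 with hm
  have hm0 : 0 < m := lt_min hσ one_pos
  have hmQ : m * (‖a‖ ^ 2 + ‖b‖ ^ 2) ≤ Q := by
    have := mul_le_mul_of_nonneg_right (min_le_left σ 1) (sq_nonneg ‖b‖)
    have := mul_le_mul_of_nonneg_right (min_le_right σ 1) (sq_nonneg ‖a‖)
    rw [hQ, hm]; linarith
  set D := Real.sqrt (‖a‖ ^ 2 + ‖b‖ ^ 2) with hD
  set E := Real.sqrt (‖e‖ ^ 2 + ‖f‖ ^ 2) with hE
  have hD2 : D ^ 2 = ‖a‖ ^ 2 + ‖b‖ ^ 2 := Real.sq_sqrt (by positivity)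
  have hE2 : E ^ 2 = ‖e‖ ^ 2 + ‖f‖ ^ 2 := Real.sq_sqrt (by positivity)
  have hD0 : 0 ≤ D := Real.sqrt_nonneg _
  have hE0 : 0 ≤ E := Real.sqrt_nonneg _
  have hcs : ‖e‖ * ‖a‖ + ‖f‖ * ‖b‖ ≤ E * D := by
    refine (pow_le_pow_iff_left₀ (by positivity) (by positivity) two_ne_zero).1 ?_
    rw [mul_pow, hD2, hE2]
    nlinarith [sq_nonneg (‖e‖ * ‖b‖ - ‖f‖ * ‖a‖)]
  rw [le_div_iff₀ hm0]
  rcases hD0.eq_or_lt with h | h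
  · rw [← h]; simpa using hE0
  · refine le_of_mul_le_mul_right ?_ h
    rw [← hD2] at hmQ
    nlinarith
end

section
/- Let S* : W → U be a bounded linear operator, ε > 0, and define T* : U × W → U × W by T*(ξ^u, ξ^w) = (ξ^u + S*ξ^w, ε ξ^w). Let z̄ = (ū, w̄) ∈ Z be the minimizer of J over Z, let z^ap = (u^ap, w^ap) ∈ Z, and suppose ζ ∈ U × W satisfies ⟨(u^ap, σw^ap) + T*ζ, z − z^ap⟩ ≥ 0 for all z ∈ Z. Then ‖ū − u^ap‖_U² + ‖w̄ − w^ap‖_W² ≤ (‖T*ζ‖ / min{σ, 1})². -/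
open scoped RealInnerProductSpace

/-- with `T*(ξ^u, ξ^w) = (ξ^u + S*ξ^w, ε ξ^w)` for a bounded linear
operator `S* : W → U` and `ε > 0`, if `z̄ ∈ Z` minimizes `J` over `Z`, `z^ap ∈ Z`, and
`ζ` satisfies `⟨(u^ap, σw^ap) + T*ζ, z − z^ap⟩ ≥ 0` for all `z ∈ Z`, then
`‖ū − u^ap‖² + ‖w̄ − w^ap‖² ≤ (‖T*ζ‖ / min{σ,1})²` (Hilbert norm on `U × W`). -/
theorem a_posteriori_error_bound_Tstar
    {U W : Type*} [NormedAddCommGroup U] [InnerProductSpace ℝ U] [CompleteSpace U]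
    [NormedAddCommGroup W] [InnerProductSpace ℝ W] [CompleteSpace W]
    (σ : ℝ) (hσ : 0 < σ) (J : U × W → ℝ)
    (hJ : ∀ z : U × W, J z = (1 / 2) * ‖z.1‖ ^ 2 + (σ / 2) * ‖z.2‖ ^ 2)
    (Z : Set (U × W)) (hne : Z.Nonempty) (hclosed : IsClosed Z) (hconv : Convex ℝ Z)
    (Sstar : W →L[ℝ] U) (ε : ℝ) (hε : 0 < ε)
    (Tstar : U × W → U × W)
    (hT : ∀ ξ : U × W, Tstar ξ = (ξ.1 + Sstar ξ.2, ε • ξ.2))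
    (zbar : U × W) (hzbar : zbar ∈ Z) (hmin : ∀ z ∈ Z, J zbar ≤ J z)
    (zap : U × W) (hzap : zap ∈ Z) (ζ : U × W)
    (hvi : ∀ z ∈ Z,
      0 ≤ ⟪zap.1 + (Tstar ζ).1, z.1 - zap.1⟫ + ⟪σ • zap.2 + (Tstar ζ).2, z.2 - zap.2⟫) :
    ‖zbar.1 - zap.1‖ ^ 2 + ‖zbar.2 - zap.2‖ ^ 2
      ≤ (Real.sqrt (‖(Tstar ζ).1‖ ^ 2 + ‖(Tstar ζ).2‖ ^ 2) / min σ 1) ^ 2 := by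
  clear hT hne hclosed
  generalize Tstar ζ = T at hvi ⊢
  obtain ⟨a, b⟩ := zap
  obtain ⟨u, w⟩ := zbar
  obtain ⟨p, q⟩ := T
  have hv := hvi _ hzbar
  simp only at hv ⊢
  obtain ⟨d, rfl⟩ : ∃ d, u = a + d := ⟨u - a, by abel⟩
  obtain ⟨e, rfl⟩ : ∃ e, w = b + e := ⟨w - b, by abel⟩
  simp only [add_sub_cancel_left, inner_add_left, real_inner_smul_left] at hv ⊢
  have key : ⟪a, d⟫ + ‖d‖ ^ 2 + σ * (⟪b, e⟫ + ‖e‖ ^ 2) ≤ 0 := by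
    set A := ⟪a, d⟫ + ‖d‖ ^ 2 + σ * (⟪b, e⟫ + ‖e‖ ^ 2) with hA
    by_contra hpos
    push Not at hpos
    set B := 1 / 2 * ‖d‖ ^ 2 + σ / 2 * ‖e‖ ^ 2 with hB
    have hB0 : 0 ≤ B := by positivity
    have hstep : ∀ t : ℝ, 0 ≤ t → t ≤ 1 → t * A ≤ t ^ 2 * B := by
      intro t h0 h1
      have hm := hconv hzbar hzap (sub_nonneg.2 h1) h0 (by ring)
      have h := hmin _ hm
      have e1 : (1 - t) • (a + d) + t • a = a + (1 - t) • d := by module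
      have e2 : (1 - t) • (b + e) + t • b = b + (1 - t) • e := by module
      simp only [hJ, Prod.smul_mk, Prod.mk_add_mk, e1, e2, norm_add_sq_real,
        real_inner_smul_right, norm_smul, mul_pow, Real.norm_eq_abs, sq_abs] at h
      rw [hA, hB]
      linarith
    have hs : 0 < A + B := by linarith
    have h := hstep (A / (A + B)) (by positivity) (by rw [div_le_one hs]; linarith)
    have h2 : A / (A + B) * A - (A / (A + B)) ^ 2 * B = A ^ 3 / (A + B) ^ 2 := by
      field_simp
      ring
    have h3 : 0 < A ^ 3 / (A + B) ^ 2 := by positivity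
    linarith
  set m := min σ 1 with hm
  have hm0 : 0 < m := lt_min hσ one_pos
  have hms : m ≤ σ := min_le_left _ _
  have hm1 : m ≤ 1 := min_le_right _ _
  have y1 := norm_sub_sq_real p (m • d)
  have y2 := norm_sub_sq_real q (m • e)
  simp only [real_inner_smul_right, norm_smul, mul_pow, Real.norm_eq_abs, sq_abs] at y1 y2
  have z1 := sq_nonneg ‖p - m • d‖
  have z2 := sq_nonneg ‖q - m • e‖
  have c1 : m * ‖d‖ ^ 2 ≤ 1 * ‖d‖ ^ 2 := by gcongr
  have c2 : m * ‖e‖ ^ 2 ≤ σ * ‖e‖ ^ 2 := by gcongr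
  have c3 : m * (‖d‖ ^ 2 + ‖e‖ ^ 2) ≤ ⟪p, d⟫ + ⟪q, e⟫ := by linarith
  have c4 := mul_le_mul_of_nonneg_left c3 hm0.le
  rw [div_pow, Real.sq_sqrt (by positivity), le_div_iff₀ (by positivity)]
  linarith
end

section
/- Let η > 0 and let y_a < y_b be real numbers. For real numbers y and μ, the equation μ = max{0, μ + η(y − y_b)} + min{0, μ + η(y − y_a)} holds if and only if the bilateral complementarity conditions hold: y_a ≤ y ≤ y_b, max{μ, 0} · (y_b − y) = 0, and min{μ, 0} · (y − y_a) = 0. -/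
/-- for `η > 0` and `y_a < y_b`, the fixed-point equation
`μ = max{0, μ + η(y − y_b)} + min{0, μ + η(y − y_a)}` holds if and only if the
bilateral complementarity conditions hold:
`y_a ≤ y ≤ y_b`, `max{μ,0}(y_b − y) = 0` and `min{μ,0}(y − y_a) = 0`. -/
theorem bilateral_complementarity_iff
    (η ya yb y μ : ℝ) (hη : 0 < η) (hab : ya < yb) :
    μ = max 0 (μ + η * (y - yb)) + min 0 (μ + η * (y - ya)) ↔
      (ya ≤ y ∧ y ≤ yb ∧ max μ 0 * (yb - y) = 0 ∧ min μ 0 * (y - ya) = 0) := by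
  have hd : 0 < η * (yb - ya) := mul_pos hη (sub_pos.2 hab)
  have e : η * (y - ya) = η * (y - yb) + η * (yb - ya) := by ring
  constructor
  · intro h
    rcases lt_or_ge 0 (μ + η * (y - yb)) with h1 | h1
    · rw [max_eq_right h1.le, min_eq_left (by linarith)] at h
      have h0 : η * (y - yb) = 0 := by linarith
      have hy : y = yb := by
        rcases mul_eq_zero.1 h0 with h2 | h2 <;> linarith
      have hm : 0 < μ := by linarith
      subst hy
      refine ⟨hab.le, le_rfl, by simp, ?_⟩
      rw [min_eq_right hm.le, zero_mul]
    · rw [max_eq_left h1] at h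
      rcases lt_or_ge (μ + η * (y - ya)) 0 with h3 | h3
      · rw [min_eq_right h3.le] at h
        have h0 : η * (y - ya) = 0 := by linarith
        have hy : y = ya := by
          rcases mul_eq_zero.1 h0 with h2 | h2 <;> linarith
        have hm : μ < 0 := by linarith
        subst hy
        refine ⟨le_rfl, hab.le, ?_, by simp⟩
        rw [max_eq_right hm.le, zero_mul]
      · rw [min_eq_left h3] at h
        have hm : μ = 0 := by linarith
        subst hm
        refine ⟨?_, ?_, by simp, by simp⟩
        · by_contra! hc
          have := mul_pos hη (sub_pos.2 hc)
          linarith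
        · by_contra! hc
          have := mul_pos hη (sub_pos.2 hc)
          linarith
  · rintro ⟨ha, hb, h1, h2⟩
    have pa := mul_nonneg hη.le (sub_nonneg.2 ha)
    have pb := mul_nonneg hη.le (sub_nonneg.2 hb)
    have eb : η * (y - yb) = -(η * (yb - y)) := by ring
    rcases lt_trichotomy μ 0 with hm | hm | hm
    · rw [min_eq_left hm.le] at h2
      have hz : y - ya = 0 := (mul_eq_zero.1 h2).resolve_left hm.ne
      rw [max_eq_left (by linarith), hz, mul_zero, min_eq_right (by linarith)]
      ring
    · rw [max_eq_left (by linarith), min_eq_left (by linarith)]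
      linarith
    · rw [max_eq_left hm.le] at h1
      have hz : yb - y = 0 := (mul_eq_zero.1 h1).resolve_left hm.ne'
      rw [min_eq_left (by linarith), eb, hz, mul_zero, max_eq_right (by linarith)]
      ring
end
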